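/- Let d ≥ 2, let g ∈ ℝ^d be nonzero, let e ∈ ℝ^d with ‖e‖ = 1 and u₀ ∈ ℝ^d with ‖u₀‖ = 1, set δ(t) := t‖g‖/(d-1), and let u(t) := (u₀ + (sinh δ(t) + ⟨e,u₀⟩(cosh δ(t) - 1)) e) / (cosh δ(t) + ⟨e,u₀⟩ sinh δ(t)) be the explicit microcanonical velocity update. Then ⟨e, u(t)⟩ = (sinh δ(t) + ⟨e,u₀⟩ cosh δ(t)) / (cosh δ(t) + ⟨e,u₀⟩ sinh δ(t)), and consequently (d-1) · (d/dt) log(cosh δ(t) + ⟨e,u₀⟩ sinh δ(t)) = ‖g‖ · ⟨e, u(t)⟩ for all t. Hence the time integral of the phase-space divergence -‖g‖⟨e,u(t)⟩ of the velocity-update flow over [0, T] equals -(d-1)·log(cosh δ(T) + ⟨e,u₀⟩ sinh δ(T)). -/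

import Mathlib

open scoped RealInnerProductSpace

/-- `cosh x + c sinh x` is positive whenever `|c| ≤ 1`. -/
theorem Real.cosh_add_mul_sinh_pos {c : ℝ} (hc : |c| ≤ 1) (x : ℝ) :
    0 < Real.cosh x + c * Real.sinh x := by
  obtain ⟨h₁, h₂⟩ := abs_le.mp hc
  rw [Real.cosh_eq, Real.sinh_eq]
  nlinarith [Real.exp_pos x, Real.exp_pos (-x),
    mul_nonneg (sub_nonneg.mpr h₂) (Real.exp_pos (-x)).le,
    mul_nonneg (neg_le_iff_add_nonneg.mp h₁) (Real.exp_pos x).le]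

/-- The derivative of `log (cosh x + c sinh x)` for `|c| ≤ 1`. -/
theorem Real.hasDerivAt_log_cosh_add_mul_sinh {c : ℝ} (hc : |c| ≤ 1) (x : ℝ) :
    HasDerivAt (fun x => Real.log (Real.cosh x + c * Real.sinh x))
      ((Real.sinh x + c * Real.cosh x) / (Real.cosh x + c * Real.sinh x)) x :=
  ((Real.hasDerivAt_cosh x).add ((Real.hasDerivAt_sinh x).const_mul c)).log
    (Real.cosh_add_mul_sinh_pos hc x).ne'

/-- Along the explicit microcanonical velocity update,
`⟨e, u(t)⟩ = (sinh δ + ⟨e,u₀⟩ cosh δ)/(cosh δ + ⟨e,u₀⟩ sinh δ)`, so the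
logarithmic derivative identity
`(d-1) (d/dt) log(cosh δ(t) + ⟨e,u₀⟩ sinh δ(t)) = ‖g‖ ⟨e, u(t)⟩` holds; hence the
time integral of the phase-space divergence `-‖g‖⟨e,u(t)⟩` over `[0,T]` equals
`-(d-1) log(cosh δ(T) + ⟨e,u₀⟩ sinh δ(T))`, the negative kinetic energy change. -/
theorem divergence_equals_kinetic_energy_change {d : ℕ} (hd : 2 ≤ d)
    (g : EuclideanSpace ℝ (Fin d)) (hg : g ≠ 0)
    (e u₀ : EuclideanSpace ℝ (Fin d)) (he : ‖e‖ = 1) (hu₀ : ‖u₀‖ = 1)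
    (δ : ℝ → ℝ) (hδ : ∀ t, δ t = t * ‖g‖ / ((d : ℝ) - 1))
    (u : ℝ → EuclideanSpace ℝ (Fin d))
    (hu : ∀ t, u t = (Real.cosh (δ t) + ⟪e, u₀⟫ * Real.sinh (δ t))⁻¹ •
      (u₀ + (Real.sinh (δ t) + ⟪e, u₀⟫ * (Real.cosh (δ t) - 1)) • e)) :
    (∀ t, ⟪e, u t⟫ = (Real.sinh (δ t) + ⟪e, u₀⟫ * Real.cosh (δ t)) /
      (Real.cosh (δ t) + ⟪e, u₀⟫ * Real.sinh (δ t))) ∧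
    (∀ t, HasDerivAt
      (fun t => ((d : ℝ) - 1) *
        Real.log (Real.cosh (δ t) + ⟪e, u₀⟫ * Real.sinh (δ t)))
      (‖g‖ * ⟪e, u t⟫) t) ∧
    (∀ T, (∫ t in (0 : ℝ)..T, -(‖g‖ * ⟪e, u t⟫)) =
      -(((d : ℝ) - 1) *
        Real.log (Real.cosh (δ T) + ⟪e, u₀⟫ * Real.sinh (δ T)))) := by
  have hc : |⟪e, u₀⟫| ≤ 1 := by simpa [he, hu₀] using abs_real_inner_le_norm e u₀
  have hd' : (d : ℝ) - 1 ≠ 0 := by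
    have : (2 : ℝ) ≤ d := by exact_mod_cast hd
    linarith
  obtain rfl : δ = fun t => t * ‖g‖ / ((d : ℝ) - 1) := funext hδ
  have hinner : ∀ t, ⟪e, u t⟫ =
      (Real.sinh (t * ‖g‖ / ((d : ℝ) - 1)) + ⟪e, u₀⟫ * Real.cosh (t * ‖g‖ / ((d : ℝ) - 1))) /
      (Real.cosh (t * ‖g‖ / ((d : ℝ) - 1)) + ⟪e, u₀⟫ * Real.sinh (t * ‖g‖ / ((d : ℝ) - 1))) := fun t => by
    rw [hu t, real_inner_smul_right, inner_add_right, real_inner_smul_right,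
      real_inner_self_eq_norm_sq, he, inv_mul_eq_div]
    congr 1
    ring
  have hderiv : ∀ t, HasDerivAt (fun t => ((d : ℝ) - 1) *
      Real.log (Real.cosh (t * ‖g‖ / ((d : ℝ) - 1)) + ⟪e, u₀⟫ * Real.sinh (t * ‖g‖ / ((d : ℝ) - 1))))
      (‖g‖ * ⟪e, u t⟫) t := fun t => by
    have hδ' : HasDerivAt (fun t : ℝ => t * ‖g‖ / ((d : ℝ) - 1)) (‖g‖ / ((d : ℝ) - 1)) t := by
      simpa using ((hasDerivAt_id t).mul_const ‖g‖).div_const ((d : ℝ) - 1)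
    refine (((Real.hasDerivAt_log_cosh_add_mul_sinh hc _).comp t hδ').const_mul
      ((d : ℝ) - 1)).congr_deriv ?_
    rw [hinner]
    field_simp
  refine ⟨hinner, hderiv, fun T => ?_⟩
  have hcont : Continuous fun t => ‖g‖ * ⟪e, u t⟫ := by
    simp_rw [hinner]
    refine continuous_const.mul (Continuous.div ?_ ?_ fun t =>
      (Real.cosh_add_mul_sinh_pos hc _).ne') <;> fun_prop
  rw [intervalIntegral.integral_neg, intervalIntegral.integral_eq_sub_of_hasDerivAt
    (fun t _ => hderiv t) (hcont.intervalIntegrable 0 T)]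
  simp
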